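/- Let A be the adjacency matrix of a loopless digraph on n vertices, D its in-degree diagonal matrix, and fix η ∈ {0,1} and α ∈ {−1,1}. For an index i with 1 ≤ i ≤ n, let (xIₙ)^{(i)} be xIₙ with its i-th diagonal entry replaced by 0 and let D^{(i)} be D with its i-th diagonal entry replaced by 0. Then d₂(xIₙ^{(i)} − ηD^{(i)} − αA) = d₂(xIₙ − ηD − αA) − (x − η·d⁻(v_i))·det[(xIₙ − ηD − αA)_i^i] − (x − η·d⁻(v_i))·d₂[(xIₙ − ηD − αA)_i^i], where M_i^i denotes the submatrix of M obtained by deleting row i and column i. -/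

import Mathlib

open Matrix Finset Polynomial

/-- The second immanant `d₂(M) = Σ_i M i i * det (M(i)) - det M`, where `M(i)` is the
submatrix of `M` obtained by deleting row `i` and column `i`. -/
noncomputable def d2 {α : Type*} [Fintype α] [DecidableEq α] {R : Type*} [CommRing R]
    (M : Matrix α α R) : R :=
  (∑ i, M i i *
    (M.submatrix (fun k : {k : α // k ≠ i} => (k : α))
      (fun k : {k : α // k ≠ i} => (k : α))).det) - M.det

/-- The matrix `x Iₙ - η D - α A` of real polynomials, where `A` is the adjacency matrix of a
loopless digraph and `D = diag(d⁻(v_1), …, d⁻(v_n))` is its diagonal matrix of in-degrees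
`d⁻(v_j) = Σ_i A i j`. -/
noncomputable def gMat (η α : ℝ) {n : ℕ} (A : Matrix (Fin n) (Fin n) ℝ) :
    Matrix (Fin n) (Fin n) (Polynomial ℝ) :=
  Matrix.diagonal (fun _ => (X : Polynomial ℝ))
    - Polynomial.C η • (Matrix.diagonal (fun j => ∑ i, A i j)).map Polynomial.C
    - Polynomial.C α • A.map Polynomial.C

/-- Changing a single diagonal entry of a matrix changes its determinant by the difference of
the entries times the corresponding principal minor. -/
theorem det_eq_add_of_eq_off_diag_entry {ι R : Type*} [Fintype ι] [DecidableEq ι] [CommRing R]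
    {M N : Matrix ι ι R} (i : ι) (h : ∀ k l, ¬(k = i ∧ l = i) → M k l = N k l) :
    M.det = N.det + (M i i - N i i) *
      (N.submatrix (fun k : {k : ι // k ≠ i} => (k : ι))
        (fun k : {k : ι // k ≠ i} => (k : ι))).det := by
  have hM : M = N.updateRow i (N i + (M i i - N i i) • Pi.single i 1) := by
    ext k l
    by_cases hk : k = i
    · subst hk
      by_cases hl : l = k
      · subst hl
        simp
      · simp [hl, h k l (fun H => hl H.2)]
    · simp [hk, h k l (fun H => hk H.1)]
  have hdet : (N.updateRow i (Pi.single i 1)).det =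
      (N.submatrix (fun k : {k : ι // k ≠ i} => (k : ι))
        (fun k : {k : ι // k ≠ i} => (k : ι))).det := by
    have htri : ∀ k, ¬ k ≠ i → ∀ l, l ≠ i → N.updateRow i (Pi.single i 1) k l = 0 := by
      intro k hk l hl
      simp [not_not.mp hk, hl]
    have hentry :
        (N.updateRow i (Pi.single i 1)).toSquareBlockProp (fun k => ¬ k ≠ i) = 1 := by
      ext ⟨k, hk⟩ ⟨l, hl⟩
      obtain rfl := not_not.mp hk
      obtain rfl := not_not.mp hl
      simp [Matrix.toSquareBlockProp]
    have hminor : (N.updateRow i (Pi.single i 1)).toSquareBlockProp (fun k => k ≠ i) =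
        N.submatrix (fun k : {k : ι // k ≠ i} => (k : ι))
          (fun k : {k : ι // k ≠ i} => (k : ι)) := by
      ext k l
      simp [Matrix.toSquareBlockProp, k.2]
    rw [Matrix.twoBlockTriangular_det _ (fun k => k ≠ i) htri, hentry, Matrix.det_one, mul_one,
      hminor]
  conv_lhs => rw [hM]
  rw [Matrix.det_updateRow_add, Matrix.det_updateRow_smul, hdet, Matrix.updateRow_eq_self]

/-- Removing two distinct points from a type in either order gives equivalent subtypes. -/
def subtypeNeSwap {ι : Type*} {i j : ι} (hij : i ≠ j) :
    {k : {k : ι // k ≠ j} // k ≠ ⟨i, hij⟩} ≃ {k : {k : ι // k ≠ i} // k ≠ ⟨j, hij.symm⟩} where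
  toFun k := ⟨⟨k.1.1, fun h => k.2 (Subtype.ext h)⟩, fun h => k.1.2 (congrArg Subtype.val h)⟩
  invFun k := ⟨⟨k.1.1, fun h => k.2 (Subtype.ext h)⟩, fun h => k.1.2 (congrArg Subtype.val h)⟩
  left_inv _ := rfl
  right_inv _ := rfl

/-- Changing a single diagonal entry of a matrix changes its second immanant by the difference of
the entries times the determinant plus the second immanant of the principal submatrix. -/
theorem d2_eq_add_of_eq_off_diag_entry {ι R : Type*} [Fintype ι] [DecidableEq ι] [CommRing R]
    {M N : Matrix ι ι R} (i : ι) (h : ∀ k l, ¬(k = i ∧ l = i) → M k l = N k l) :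
    d2 M = d2 N + (M i i - N i i) *
      ((N.submatrix (fun k : {k : ι // k ≠ i} => (k : ι))
        (fun k : {k : ι // k ≠ i} => (k : ι))).det +
      d2 (N.submatrix (fun k : {k : ι // k ≠ i} => (k : ι))
        (fun k : {k : ι // k ≠ i} => (k : ι)))) := by
  have hi : M.submatrix (fun k : {k : ι // k ≠ i} => (k : ι))
      (fun k : {k : ι // k ≠ i} => (k : ι)) =
      N.submatrix (fun k : {k : ι // k ≠ i} => (k : ι))
        (fun k : {k : ι // k ≠ i} => (k : ι)) := by
    ext k l
    exact h k l fun H => k.2 H.1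
  have hj (j : {j : ι // j ≠ i}) : M j j *
      (M.submatrix (fun k : {k : ι // k ≠ j} => (k : ι))
        (fun k : {k : ι // k ≠ j} => (k : ι))).det =
      N j j * (N.submatrix (fun k : {k : ι // k ≠ j} => (k : ι))
        (fun k : {k : ι // k ≠ j} => (k : ι))).det + (M i i - N i i) *
      (N j j * (((N.submatrix (fun k : {k : ι // k ≠ i} => (k : ι))
        (fun k : {k : ι // k ≠ i} => (k : ι))).submatrix
          (fun k : {k : {k : ι // k ≠ i} // k ≠ j} => (k : {k : ι // k ≠ i}))
          (fun k : {k : {k : ι // k ≠ i} // k ≠ j} => (k : {k : ι // k ≠ i}))).det)) := by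
    obtain ⟨j, hji⟩ := j
    have hswap : ((N.submatrix (fun k : {k : ι // k ≠ j} => (k : ι))
        (fun k : {k : ι // k ≠ j} => (k : ι))).submatrix
          (fun k : {k : {k : ι // k ≠ j} // k ≠ ⟨i, hji.symm⟩} => (k : {k : ι // k ≠ j}))
          (fun k : {k : {k : ι // k ≠ j} // k ≠ ⟨i, hji.symm⟩} => (k : {k : ι // k ≠ j}))).det =
        ((N.submatrix (fun k : {k : ι // k ≠ i} => (k : ι))
          (fun k : {k : ι // k ≠ i} => (k : ι))).submatrix
            (fun k : {k : {k : ι // k ≠ i} // k ≠ ⟨j, hji⟩} => (k : {k : ι // k ≠ i}))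
            (fun k : {k : {k : ι // k ≠ i} // k ≠ ⟨j, hji⟩} => (k : {k : ι // k ≠ i}))).det :=
      Matrix.det_submatrix_equiv_self (subtypeNeSwap hji.symm)
        ((N.submatrix (fun k : {k : ι // k ≠ i} => (k : ι))
          (fun k : {k : ι // k ≠ i} => (k : ι))).submatrix
            (fun k : {k : {k : ι // k ≠ i} // k ≠ ⟨j, hji⟩} => (k : {k : ι // k ≠ i}))
            (fun k : {k : {k : ι // k ≠ i} // k ≠ ⟨j, hji⟩} => (k : {k : ι // k ≠ i})))
    have hminor := det_eq_add_of_eq_off_diag_entry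
      (M := M.submatrix (fun k : {k : ι // k ≠ j} => (k : ι))
        (fun k : {k : ι // k ≠ j} => (k : ι)))
      (N := N.submatrix (fun k : {k : ι // k ≠ j} => (k : ι))
        (fun k : {k : ι // k ≠ j} => (k : ι)))
      ⟨i, hji.symm⟩ (fun k l hkl => h k l fun H => hkl ⟨Subtype.ext H.1, Subtype.ext H.2⟩)
    rw [hswap] at hminor
    simp only [Matrix.submatrix_apply] at hminor
    rw [hminor, h j j fun H => hji H.1]
    ring
  unfold d2
  rw [Fintype.sum_eq_add_sum_subtype_ne _ i, Fintype.sum_eq_add_sum_subtype_ne _ i, hi,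
    Finset.sum_congr rfl fun j _ => hj j, Finset.sum_add_distrib, ← Finset.mul_sum,
    det_eq_add_of_eq_off_diag_entry i h]
  simp only [Matrix.submatrix_apply]
  ring

/-- Let `A` be the adjacency matrix of a loopless digraph on `n` vertices, `D`
its in-degree diagonal matrix, and fix `η ∈ {0,1}`, `α ∈ {-1,1}`. With `(x Iₙ)^(i)` and
`D^(i)` denoting `x Iₙ` and `D` with the `i`-th diagonal entry replaced by `0`,
`d₂(x Iₙ^(i) - η D^(i) - α A) = d₂(x Iₙ - η D - α A)
  - (x - η d⁻(v_i)) · det[(x Iₙ - η D - α A)_i^i]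
  - (x - η d⁻(v_i)) · d₂[(x Iₙ - η D - α A)_i^i]`. -/
theorem d2_zero_diagonal_entry_digraph {n : ℕ} (A : Matrix (Fin n) (Fin n) ℝ)
    (hA : ∀ i j, A i j = 0 ∨ A i j = 1) (hdiag : ∀ i, A i i = 0)
    (η α : ℝ) (hη : η = 0 ∨ η = 1) (hα : α = -1 ∨ α = 1) (i : Fin n) :
    d2 (Matrix.diagonal (fun k : Fin n => if k = i then (0 : Polynomial ℝ) else X)
          - Polynomial.C η •
            (Matrix.diagonal (fun j : Fin n =>
              if j = i then (0 : ℝ) else ∑ k, A k j)).map Polynomial.C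
          - Polynomial.C α • A.map Polynomial.C)
      = d2 (gMat η α A)
        - (X - Polynomial.C (η * ∑ k, A k i)) *
            ((gMat η α A).submatrix (fun k : {k : Fin n // k ≠ i} => (k : Fin n))
              (fun k : {k : Fin n // k ≠ i} => (k : Fin n))).det
        - (X - Polynomial.C (η * ∑ k, A k i)) *
            d2 ((gMat η α A).submatrix (fun k : {k : Fin n // k ≠ i} => (k : Fin n))
              (fun k : {k : Fin n // k ≠ i} => (k : Fin n))) := by
  set N := Matrix.diagonal (fun k : Fin n => if k = i then (0 : Polynomial ℝ) else X)
          - Polynomial.C η •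
            (Matrix.diagonal (fun j : Fin n =>
              if j = i then (0 : ℝ) else ∑ k, A k j)).map Polynomial.C
          - Polynomial.C α • A.map Polynomial.C with hN
  have h : ∀ k l, ¬(k = i ∧ l = i) → N k l = gMat η α A k l := by
    intro k l hkl
    by_cases hk : k = l
    · subst hk
      have hki : k ≠ i := fun H => hkl ⟨H, H⟩
      simp [hN, gMat, hki]
    · simp [hN, gMat, hk]
  have hii : N i i - gMat η α A i i = -(X - Polynomial.C (η * ∑ k, A k i)) := by
    simp [hN, gMat]
    ring
  rw [d2_eq_add_of_eq_off_diag_entry i h, hii]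
  ring
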